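/- Let n ∈ ℕ, n ≥ 1, and T_0 = π/(2n). Then T_opt(T_0) = 2π, the left limit of T_opt at T_0 is 3π (i.e. T_opt(t) → 3π as t → T_0 with t < T_0), and the right limit of T_opt at T_0 is 3π − π/(2n) (i.e. T_opt(t) → 3π − π/(2n) as t → T_0 with t > T_0). -/

import Mathlib

open MeasureTheory Set Real Filter Topology

noncomputable section

instance : Fact (0 < 2 * Real.pi) := ⟨by positivity⟩

/-- λ_k: 0 for even k, π for odd k. -/
def lam (k : ℕ) : ℝ := if Even k then 0 else Real.pi

/-- Covered set D(T₀, t) ⊆ ℝ/(2πℤ): the union over k of the projections of the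
observation intervals (k·T₀, min((k+1)·T₀, t)) translated by −λ_k. -/
def coveredSet (T0 t : ℝ) : Set (AddCircle (2 * Real.pi)) :=
  ⋃ k : ℕ, (fun a : ℝ => ((a - lam k : ℝ) : AddCircle (2 * Real.pi))) ''
    Set.Ioo ((k : ℝ) * T0) (min (((k : ℝ) + 1) * T0) t)

/-- Optimal control time T_opt(T₀). -/
def Topt (T0 : ℝ) : ℝ :=
  sInf { t : ℝ | 0 < t ∧ volume (coveredSet T0 t)ᶜ = 0 }

lemma lam_val (k : ℕ) : ∃ e : ℤ, lam k = e * Real.pi ∧ Even ((k : ℤ) + e) := by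
  unfold lam
  split_ifs with h
  · exact ⟨0, by simp, by simpa using (by exact_mod_cast h)⟩
  · refine ⟨1, by simp, ?_⟩
    have := Nat.not_even_iff_odd.1 h
    have h2 : Odd (k : ℤ) := by exact_mod_cast this
    exact h2.add_odd odd_one

lemma circ_eq_iff (x y : ℝ) : ((x : AddCircle (2 * Real.pi)) = y) ↔
    ∃ m : ℤ, x = y + m * (2 * Real.pi) := by
  rw [← sub_eq_zero, ← AddCircle.coe_sub, AddCircle.coe_eq_zero_iff]
  refine exists_congr fun m => ?_
  rw [zsmul_eq_mul]
  constructor <;> intro h <;> linarith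

lemma cov_of {T t y : ℝ} {i j k : ℕ} (h1 : k * T < y + j * Real.pi)
    (h2 : y + j * Real.pi < (k + 1) * T) (h3 : y + j * Real.pi < t) (h : Even (k + j + i)) :
    ((y + i * Real.pi : ℝ) : AddCircle (2 * Real.pi)) ∈ coveredSet T t := by
  obtain ⟨e, he, hev⟩ := lam_val k
  refine mem_iUnion.2 ⟨k, y + j * Real.pi, ⟨h1, lt_min h2 h3⟩, ?_⟩
  have h' : Even ((k : ℤ) + j + i) := by exact_mod_cast h
  obtain ⟨a, ha⟩ := hev
  obtain ⟨b, hb⟩ := h'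
  have hmr : (j : ℝ) - e = i + 2 * ((b - a - i : ℤ) : ℝ) := by
    have : (j : ℤ) - e = i + 2 * (b - a - i) := by lia
    exact_mod_cast this
  simp only
  rw [circ_eq_iff, he]
  refine ⟨b - a - i, ?_⟩
  linear_combination Real.pi * hmr

lemma of_cov {T t y : ℝ} (hT : 0 < T) (hy : y < Real.pi) {i : ℕ}
    (h : ((y + i * Real.pi : ℝ) : AddCircle (2 * Real.pi)) ∈ coveredSet T t) :
    ∃ j k : ℕ, k * T < y + j * Real.pi ∧ y + j * Real.pi < (k + 1) * T ∧
      y + j * Real.pi < t ∧ Even (k + j + i) := by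
  obtain ⟨k, s, ⟨h1, h2⟩, h3⟩ := mem_iUnion.1 h
  obtain ⟨e, he, hev⟩ := lam_val k
  simp only at h3
  rw [circ_eq_iff, he] at h3
  obtain ⟨m, hm⟩ := h3
  have hs : s = y + ((i + e + 2 * m : ℤ) : ℝ) * Real.pi := by
    push_cast; linear_combination hm
  have hpos : 0 < s := lt_of_le_of_lt (by positivity) h1
  have hj : 0 ≤ (i + e + 2 * m : ℤ) := by
    by_contra hneg
    have : (i + e + 2 * m : ℤ) ≤ -1 := by lia
    have h4 : ((i + e + 2 * m : ℤ) : ℝ) ≤ -1 := by exact_mod_cast this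
    nlinarith [Real.pi_pos]
  obtain ⟨j, hj⟩ := Int.eq_ofNat_of_zero_le hj
  rw [hj] at hs
  simp only [Int.cast_natCast] at hs
  obtain ⟨h2, h2'⟩ := lt_min_iff.1 h2
  refine ⟨j, k, by rwa [← hs], by rwa [← hs], by rwa [← hs], ?_⟩
  obtain ⟨a, ha⟩ := hev
  have : Even ((k : ℤ) + j + i) := ⟨a + i + m, by lia⟩
  exact_mod_cast this

lemma k_unique {T z : ℝ} (hT : 0 < T) {k l : ℕ} (h1 : k * T < z) (h2 : z < (k + 1) * T)
    (h3 : l * T < z) (h4 : z < (l + 1) * T) : k = l := by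
  have a : (k : ℝ) < l + 1 := lt_of_mul_lt_mul_right (h1.trans h4) hT.le
  have b : (l : ℝ) < k + 1 := lt_of_mul_lt_mul_right (h3.trans h2) hT.le
  have a' : k < l + 1 := by exact_mod_cast a
  have b' : l < k + 1 := by exact_mod_cast b
  lia

lemma cov_open (T t : ℝ) : IsOpen (coveredSet T t) := by
  refine isOpen_iUnion fun k => ?_
  have : (fun a : ℝ => ((a - lam k : ℝ) : AddCircle (2 * Real.pi))) =
      (fun a : ℝ => (a : AddCircle (2 * Real.pi))) ∘ (fun a => a - lam k) := rfl
  rw [this, image_comp]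
  exact QuotientAddGroup.isOpenMap_coe _ ((Homeomorph.subRight (lam k)).isOpenMap _ isOpen_Ioo)

/-- generic points -/
def Gen (T y : ℝ) : Prop := ∀ a b : ℤ, y ≠ a * T + b * Real.pi

lemma null_of {T t : ℝ} (h : ∀ y, 0 < y → y < Real.pi → Gen T y → ∀ i : ℕ,
    ((y + i * Real.pi : ℝ) : AddCircle (2 * Real.pi)) ∈ coveredSet T t) :
    volume (coveredSet T t)ᶜ = 0 := by
  have hc : (range fun p : ℤ × ℤ => (p.1 * T + p.2 * Real.pi : ℝ)).Countable := countable_range _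
  have hm := (AddCircle.measurePreserving_mk (2 * Real.pi) 0)
  rw [← hm.measure_preimage (cov_open T t).measurableSet.compl.nullMeasurableSet,
    Measure.restrict_apply (hm.measurable (cov_open T t).measurableSet.compl)]
  refine measure_mono_null ?_ (hc.measure_zero volume)
  rintro x ⟨hx, hx0, hx1⟩
  by_contra hg
  have hgen : Gen T x := fun a b hab => hg ⟨(a, b), hab.symm⟩
  apply hx
  show (x : AddCircle (2 * Real.pi)) ∈ coveredSet T t
  rcases lt_or_ge x Real.pi with hlt | hge
  · simpa using h x hx0 hlt hgen 0
  · have hne : x ≠ Real.pi := by simpa using hgen 0 1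
    have hne2 : x ≠ 2 * Real.pi := by simpa using hgen 0 2
    have := h (x - Real.pi) (by have := lt_of_le_of_ne hge hne.symm; linarith)
      (by have := lt_of_le_of_ne hx1 (by simpa using hne2); linarith)
      (fun a b hab => hgen a (b + 1) (by push_cast; linarith)) 1
    simpa using this

lemma not_null_of {T t a b : ℝ} (hab : a < b) (h : ∀ y, a < y → y < b →
    ((y : ℝ) : AddCircle (2 * Real.pi)) ∉ coveredSet T t) :
    volume (coveredSet T t)ᶜ ≠ 0 := by
  have ho : IsOpen ((fun a : ℝ => (a : AddCircle (2 * Real.pi))) '' Ioo a b) :=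
    QuotientAddGroup.isOpenMap_coe _ isOpen_Ioo
  have hp := ho.measure_pos volume ((nonempty_Ioo.2 hab).image _)
  refine (lt_of_lt_of_le hp (measure_mono ?_)).ne'
  rintro _ ⟨y, hy, rfl⟩
  exact h y hy.1 hy.2

lemma topt_eq {T c : ℝ} (hT : 0 < T) (hc : 0 < c)
    (hup : ∀ y, 0 < y → y < Real.pi → Gen T y → ∀ i : ℕ,
      ∃ j k : ℕ, k * T < y + j * Real.pi ∧ y + j * Real.pi < (k + 1) * T ∧
        y + j * Real.pi < c ∧ Even (k + j + i))
    (hlow : ∀ t < c, ∃ a b, a < b ∧ ∀ y, a < y → y < b → y < Real.pi ∧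
      ∀ j k : ℕ, k * T < y + j * Real.pi → y + j * Real.pi < (k + 1) * T →
        y + j * Real.pi < t → ¬ Even (k + j)) : Topt T = c := by
  refine IsLeast.csInf_eq ⟨⟨hc, ?_⟩, ?_⟩
  · refine null_of fun y h0 h1 hg i => ?_
    obtain ⟨j, k, h2, h3, h4, h5⟩ := hup y h0 h1 hg i
    exact cov_of h2 h3 h4 h5
  · rintro t ⟨ht, hnull⟩
    by_contra hlt
    obtain ⟨a, b, hab, h⟩ := hlow t (not_le.1 hlt)
    refine not_null_of hab (fun y ha hb hmem => ?_) hnull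
    obtain ⟨hy, h⟩ := h y ha hb
    obtain ⟨j, k, h2, h3, h4, h5⟩ := of_cov (i := 0) hT hy (by simpa using hmem)
    exact h j k h2 h3 h4 (by simpa using h5)

lemma gen_floor {T y : ℝ} (hT : 0 < T) (hy : 0 < y) (hg : Gen T y) :
    ∃ k : ℕ, k * T < y ∧ y < (k + 1) * T := by
  refine ⟨⌊y / T⌋₊, ?_, ?_⟩
  · refine lt_of_le_of_ne ?_ (fun h => hg ⌊y / T⌋₊ 0 (by push_cast; linarith))
    exact (le_div_iff₀ hT).1 (Nat.floor_le (by positivity))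
  · exact (div_lt_iff₀ hT).1 (Nat.lt_floor_add_one _)


lemma case_eq (n : ℕ) (hn : 1 ≤ n) {T : ℝ} (hT : 0 < T) (h : 2 * n * T = Real.pi) :
    Topt T = 2 * Real.pi := by
  have hpi := Real.pi_pos
  refine topt_eq hT (by positivity) ?_ ?_
  · intro y h0 h1 hg i
    obtain ⟨k, hk1, hk2⟩ := gen_floor hT h0 hg
    by_cases hp : Even (k + i)
    · exact ⟨0, k, by simpa using hk1, by simpa using hk2, by push_cast; linarith, by simpa using hp⟩
    · refine ⟨1, k + 2 * n, by push_cast; linarith, by push_cast; linarith,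
        by push_cast; linarith, ?_⟩
      grind
  · intro t ht
    refine ⟨max (t - Real.pi) (Real.pi - T), Real.pi, by simp; constructor <;> linarith, ?_⟩
    intro y ha hb
    obtain ⟨ha1, ha2⟩ := max_lt_iff.1 ha
    refine ⟨hb, fun j k h1 h2 h3 => ?_⟩
    have hj : j = 0 := by
      by_contra hj
      have : (1 : ℝ) ≤ j := by exact_mod_cast Nat.one_le_iff_ne_zero.2 hj
      nlinarith
    subst hj
    obtain ⟨p, rfl⟩ : ∃ p, n = p + 1 := ⟨n - 1, by lia⟩
    push_cast at h h1 h2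
    have := k_unique hT h1 h2 (l := 2 * p + 1) (by push_cast; linarith) (by push_cast; linarith)
    grind

lemma case_lt (n : ℕ) (hn : 1 ≤ n) {T : ℝ} (hT : 0 < T) (h : 2 * n * T < Real.pi)
    (h' : 2 * (Real.pi - 2 * n * T) < T) :
    Topt T = 2 * Real.pi + 2 * n * T := by
  have hpi := Real.pi_pos
  have hn' : (1 : ℝ) ≤ n := by exact_mod_cast hn
  have hnT : T ≤ n * T := by nlinarith
  refine topt_eq hT (by positivity) ?_ ?_
  · intro y h0 h1 hg i
    obtain ⟨k, hk1, hk2⟩ := gen_floor hT h0 hg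
    by_cases hp : Even (k + i)
    · exact ⟨0, k, by simpa using hk1, by simpa using hk2, by push_cast; linarith, by simpa using hp⟩
    · have hne : y + Real.pi - 2 * n * T ≠ (k + 1) * T := fun e =>
        hg (2 * n + k + 1) (-1) (by push_cast; linarith)
      rcases lt_or_gt_of_ne hne with hl | hl
      · refine ⟨1, k + 2 * n, by push_cast; linarith, by push_cast; linarith,
          by push_cast; linarith, ?_⟩
        grind
      · have hk : k < 2 * n := by
          by_contra hk
          have : (2 : ℝ) * n ≤ k := by exact_mod_cast not_lt.1 hk
          nlinarith
        have hk' : (k : ℝ) + 1 ≤ 2 * n := by exact_mod_cast hk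
        have hk3 := mul_le_mul_of_nonneg_right hk' hT.le
        refine ⟨2, k + 1 + 4 * n, by push_cast; linarith, by push_cast; linarith,
          by push_cast; linarith, ?_⟩
        grind
  · intro t ht
    refine ⟨max (t - 2 * Real.pi) (4 * n * T - Real.pi), 2 * n * T,
      by simp only [max_lt_iff]; constructor <;> linarith, ?_⟩
    intro y ha hb
    obtain ⟨ha1, ha2⟩ := max_lt_iff.1 ha
    refine ⟨by linarith, fun j k h1 h2 h3 => ?_⟩
    have hj : j < 2 := by
      by_contra hj
      have : (2 : ℝ) ≤ j := by exact_mod_cast not_lt.1 hj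
      nlinarith
    obtain ⟨p, rfl⟩ : ∃ p, n = p + 1 := ⟨n - 1, by lia⟩
    push_cast at *
    interval_cases j
    · push_cast at h1 h2
      have := k_unique hT h1 h2 (l := 2 * p + 1) (by push_cast; linarith) (by push_cast; linarith)
      grind
    · push_cast at h1 h2
      have := k_unique hT h1 h2 (l := 4 * p + 4) (by push_cast; linarith) (by push_cast; linarith)
      grind

lemma case_gt (n : ℕ) (hn : 1 ≤ n) {T : ℝ} (hT : 0 < T) (h : Real.pi < 2 * n * T)
    (h' : 2 * (2 * n * T - Real.pi) < T) :
    Topt T = Real.pi + (4 * n - 1) * T := by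
  have hpi := Real.pi_pos
  have hn' : (1 : ℝ) ≤ n := by exact_mod_cast hn
  have hnT : T ≤ n * T := by nlinarith
  refine topt_eq hT (by nlinarith) ?_ ?_
  · intro y h0 h1 hg i
    obtain ⟨k, hk1, hk2⟩ := gen_floor hT h0 hg
    have hk : k < 2 * n := by
      by_contra hk
      have : (2 : ℝ) * n ≤ k := by exact_mod_cast not_lt.1 hk
      nlinarith
    have hk' : (k : ℝ) + 1 ≤ 2 * n := by exact_mod_cast hk
    have hk3 := mul_le_mul_of_nonneg_right hk' hT.le
    by_cases hp : Even (k + i)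
    · exact ⟨0, k, by simpa using hk1, by simpa using hk2, by push_cast; linarith, by simpa using hp⟩
    · have hne : y + Real.pi - 2 * n * T ≠ k * T := fun e =>
        hg (2 * n + k) (-1) (by push_cast; linarith)
      rcases lt_or_gt_of_ne hne with hl | hl
      · obtain ⟨p, rfl⟩ : ∃ p, n = p + 1 := ⟨n - 1, by lia⟩
        push_cast at *
        refine ⟨2, k + 3 + 4 * p, by push_cast; linarith, by push_cast; linarith,
          by push_cast; linarith, ?_⟩
        grind
      · refine ⟨1, k + 2 * n, by push_cast; linarith, by push_cast; linarith,
          by push_cast; linarith, ?_⟩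
        grind
  · intro t ht
    refine ⟨max (t - 2 * Real.pi) ((2 * n - 1) * T), (4 * n - 1) * T - Real.pi,
      by simp only [max_lt_iff]; constructor <;> linarith, ?_⟩
    intro y ha hb
    obtain ⟨ha1, ha2⟩ := max_lt_iff.1 ha
    refine ⟨by linarith, fun j k h1 h2 h3 => ?_⟩
    have hj : j < 2 := by
      by_contra hj
      have : (2 : ℝ) ≤ j := by exact_mod_cast not_lt.1 hj
      nlinarith
    obtain ⟨p, rfl⟩ : ∃ p, n = p + 1 := ⟨n - 1, by lia⟩
    push_cast at *
    interval_cases j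
    · push_cast at h1 h2
      have := k_unique hT h1 h2 (l := 2 * p + 1) (by push_cast; linarith) (by push_cast; linarith)
      grind
    · push_cast at h1 h2
      have := k_unique hT h1 h2 (l := 4 * p + 2) (by push_cast; linarith) (by push_cast; linarith)
      grind

/-- Proposition 4.2: at T₀ = π/(2n) one has T_opt(T₀) = 2π, the left limit of
T_opt is 3π and the right limit is 3π − π/(2n). -/
theorem stmt_16 (n : ℕ) (hn : 1 ≤ n) (T0 : ℝ) (hT0 : T0 = Real.pi / (2 * n)) :
    Topt T0 = 2 * Real.pi ∧
    Filter.Tendsto Topt (nhdsWithin T0 (Set.Iio T0)) (nhds (3 * Real.pi)) ∧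
    Filter.Tendsto Topt (nhdsWithin T0 (Set.Ioi T0))
      (nhds (3 * Real.pi - Real.pi / (2 * n))) := by
  have hn' : (1 : ℝ) ≤ n := by exact_mod_cast hn
  have hpi := Real.pi_pos
  have hTpos : 0 < T0 := by rw [hT0]; positivity
  have hE : 2 * n * T0 = Real.pi := by rw [hT0]; field_simp
  have hev : ∀ᶠ T in 𝓝 T0, 0 < T ∧ 2 * (Real.pi - 2 * n * T) < T ∧
      2 * (2 * n * T - Real.pi) < T := by
    refine (lt_mem_nhds hTpos).and (Filter.Eventually.and ?_ ?_)
    · exact ContinuousAt.eventually_lt (by fun_prop) (by fun_prop) (by linarith)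
    · exact ContinuousAt.eventually_lt (by fun_prop) (by fun_prop) (by linarith)
  refine ⟨case_eq n hn hTpos hE, ?_, ?_⟩
  · have hc : Tendsto (fun T : ℝ => 2 * Real.pi + 2 * n * T) (𝓝[<] T0) (𝓝 (3 * Real.pi)) := by
      have : ContinuousAt (fun T : ℝ => 2 * Real.pi + 2 * n * T) T0 := by fun_prop
      have h2 := this.tendsto.mono_left (nhdsWithin_le_nhds (s := Iio T0))
      convert h2 using 2
      linarith
    refine hc.congr' ?_
    filter_upwards [nhdsWithin_le_nhds hev, self_mem_nhdsWithin] with T h1 h2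
    refine (case_lt n hn h1.1 ?_ h1.2.1).symm
    have h2 : T < T0 := h2
    nlinarith
  · have hc : Tendsto (fun T : ℝ => Real.pi + (4 * n - 1) * T) (𝓝[>] T0)
        (𝓝 (3 * Real.pi - Real.pi / (2 * n))) := by
      have : ContinuousAt (fun T : ℝ => Real.pi + (4 * n - 1) * T) T0 := by fun_prop
      have h2 := this.tendsto.mono_left (nhdsWithin_le_nhds (s := Ioi T0))
      convert h2 using 2
      linarith
    refine hc.congr' ?_
    filter_upwards [nhdsWithin_le_nhds hev, self_mem_nhdsWithin] with T h1 h2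
    refine (case_gt n hn h1.1 ?_ h1.2.2).symm
    have h2 : T0 < T := h2
    nlinarith
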